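/- arXiv:0910.2059 — 4 statements merged into one kernel-verified Lean document; each statement's English description precedes it below -/
import Mathlib

section
/- If the rule set D includes the Assumption rule, then Φ ⊆ F^S is D-maximal (i.e., a D-consistent covering) if and only if Φ is a minimal covering and Φ is D-expanded. -/
/-! Common development: first-order syntax with NOR and a single quantifier,
sequent rules, derivations, consistency, semantics. Variables are indexed by ℕ
(the countably infinite variable set X). -/

/-- The alphabet: symbols of `S`, variables, and the logical symbols `↓ ≡ ∃`. -/
inductive Alph (S : Type) : Type where
  | sym : S → Alph S
  | var : ℕ → Alph S
  | nor : Alph S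
  | eqs : Alph S
  | exs : Alph S

/-- Terms over a symbol set `S` with signed arity `ar`. -/
inductive Tm (S : Type) (ar : S → ℤ) : Type where
  | var : ℕ → Tm S ar
  | const : (s : S) → ar s = 0 → Tm S ar
  | func : (s : S) → 0 < ar s → (Fin (ar s).toNat → Tm S ar) → Tm S ar

/-- Formulas over `S`: equality, relational atoms, NOR, existential quantification. -/
inductive Fm (S : Type) (ar : S → ℤ) : Type where
  | eq : Tm S ar → Tm S ar → Fm S ar
  | rel : (s : S) → ar s < 0 → (Fin (-ar s).toNat → Tm S ar) → Fm S ar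
  | nor : Fm S ar → Fm S ar → Fm S ar
  | ex : ℕ → Fm S ar → Fm S ar

variable {S : Type} {ar : S → ℤ}

/-- `¬φ` abbreviates `↓φφ`. -/
def Fm.neg (φ : Fm S ar) : Fm S ar := Fm.nor φ φ

/-- Substitution of a term for a variable in a term. -/
def Tm.substT : Tm S ar → ℕ → Tm S ar → Tm S ar
  | Tm.var n, x, u => if n = x then u else Tm.var n
  | Tm.const s h, _, _ => Tm.const s h
  | Tm.func s h ts, x, u => Tm.func s h (fun i => (ts i).substT x u)

/-- Substitution `φ[u/x]` of a term for the free occurrences of a variable in a formula. -/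
def Fm.substF : Fm S ar → ℕ → Tm S ar → Fm S ar
  | Fm.eq t₁ t₂, x, u => Fm.eq (t₁.substT x u) (t₂.substT x u)
  | Fm.rel s h ts, x, u => Fm.rel s h (fun i => (ts i).substT x u)
  | Fm.nor φ ψ, x, u => Fm.nor (φ.substF x u) (ψ.substF x u)
  | Fm.ex y φ, x, u => if y = x then Fm.ex y φ else Fm.ex y (φ.substF x u)

/-- Variables occurring in a term. -/
def Tm.varsT : Tm S ar → Set ℕ
  | Tm.var n => {n}
  | Tm.const _ _ => ∅
  | Tm.func _ _ ts => ⋃ i, (ts i).varsT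

/-- Free variables of a formula. -/
def Fm.freeF : Fm S ar → Set ℕ
  | Fm.eq t₁ t₂ => t₁.varsT ∪ t₂.varsT
  | Fm.rel _ _ ts => ⋃ i, (ts i).varsT
  | Fm.nor φ ψ => φ.freeF ∪ ψ.freeF
  | Fm.ex y φ => φ.freeF \ {y}

/-- Free variables of a set of formulas. -/
def FreeSet (Φ : Set (Fm S ar)) : Set ℕ := ⋃ φ ∈ Φ, φ.freeF

/-- Atomic formulas: equalities and relational atoms. -/
def Fm.Atomic : Fm S ar → Prop
  | Fm.eq _ _ => True
  | Fm.rel _ _ _ => True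
  | _ => False

/-- The ten basic sequent rules. -/
inductive Rule : Type where
  | ass | ant | refl | subst | exS | exA | norI | norS | ctrP | ctrN
  deriving DecidableEq

noncomputable instance : DecidableEq (Fm S ar) := Classical.decEq _

/-- Derivability of a sequent `Γ φ` using only the rules in `D`. -/
inductive Der (D : Set Rule) : Finset (Fm S ar) → Fm S ar → Prop where
  | ass : Rule.ass ∈ D → ∀ {Γ : Finset (Fm S ar)} {φ : Fm S ar}, φ ∈ Γ → Der D Γ φ
  | ant : Rule.ant ∈ D → ∀ {Γ Γ' : Finset (Fm S ar)} {φ : Fm S ar},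
      Γ ⊆ Γ' → Der D Γ φ → Der D Γ' φ
  | refl : Rule.refl ∈ D → ∀ t : Tm S ar, Der D ∅ (Fm.eq t t)
  | subst : Rule.subst ∈ D → ∀ {Γ : Finset (Fm S ar)} (φ : Fm S ar) (x : ℕ) (t t' : Tm S ar),
      Der D Γ (φ.substF x t) → Der D (insert (Fm.eq t t') Γ) (φ.substF x t')
  | exS : Rule.exS ∈ D → ∀ {Γ : Finset (Fm S ar)} (φ : Fm S ar) (x : ℕ) (t : Tm S ar),
      Der D Γ (φ.substF x t) → Der D Γ (Fm.ex x φ)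
  | exA : Rule.exA ∈ D → ∀ {Γ : Finset (Fm S ar)} (φ ψ : Fm S ar) (x x' : ℕ),
      x' ∉ FreeSet ((↑Γ : Set (Fm S ar)) ∪ {Fm.ex x φ, ψ}) →
      Der D (insert (φ.substF x (Tm.var x')) Γ) ψ → Der D (insert (Fm.ex x φ) Γ) ψ
  | norI : Rule.norI ∈ D → ∀ {Γ : Finset (Fm S ar)} {φ₁ φ₂ : Fm S ar},
      Der D Γ (Fm.nor φ₁ φ₁) → Der D Γ (Fm.nor φ₂ φ₂) → Der D Γ (Fm.nor φ₁ φ₂)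
  | norS : Rule.norS ∈ D → ∀ {Γ : Finset (Fm S ar)} {φ₁ φ₂ : Fm S ar},
      Der D Γ (Fm.nor φ₁ φ₂) → Der D Γ (Fm.nor φ₂ φ₁)
  | ctrP : Rule.ctrP ∈ D → ∀ {Γ : Finset (Fm S ar)} {φ ψ : Fm S ar},
      Der D (insert φ Γ) ψ → Der D (insert φ Γ) ψ.neg → Der D Γ φ.neg
  | ctrN : Rule.ctrN ∈ D → ∀ {Γ : Finset (Fm S ar)} {φ ψ : Fm S ar},
      Der D (insert φ.neg Γ) ψ → Der D (insert φ.neg Γ) ψ.neg → Der D Γ φ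

/-- `Φ ⊢_D φ` : some sequent `Γ φ` with `Γ` a finite subset of `Φ` is derivable using rules of `D`. -/
def Derives (D : Set Rule) (Φ : Set (Fm S ar)) (φ : Fm S ar) : Prop :=
  ∃ Γ : Finset (Fm S ar), (↑Γ : Set (Fm S ar)) ⊆ Φ ∧ Der D Γ φ

/-- `Φ` is `D`-consistent. -/
def Consistent (D : Set Rule) (Φ : Set (Fm S ar)) : Prop :=
  ¬ ∃ φ : Fm S ar, Derives D Φ φ ∧ Derives D Φ φ.neg

/-- `Φ` is a covering: it contains `φ` or `¬φ` for every formula `φ`. -/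
def Covering (Φ : Set (Fm S ar)) : Prop := ∀ φ : Fm S ar, φ ∈ Φ ∨ φ.neg ∈ Φ

/-- `Φ` is a minimal covering: exactly one of `φ`, `¬φ` belongs to `Φ`. -/
def MinimalCovering (Φ : Set (Fm S ar)) : Prop :=
  ∀ φ : Fm S ar, (φ ∈ Φ ∧ φ.neg ∉ Φ) ∨ (φ ∉ Φ ∧ φ.neg ∈ Φ)

/-- `Φ` is `D`-expanded: everything derivable from `Φ` is already in `Φ`. -/
def Expanded (D : Set Rule) (Φ : Set (Fm S ar)) : Prop :=
  ∀ φ : Fm S ar, Derives D Φ φ → φ ∈ Φ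

/-- `Φ` is `D`-maximal: a `D`-consistent covering. -/
def DMaximal (D : Set Rule) (Φ : Set (Fm S ar)) : Prop := Consistent D Φ ∧ Covering Φ

/-- `Φ` is witness-furnished. -/
def WitnessFurnished (Φ : Set (Fm S ar)) : Prop :=
  ∀ (x : ℕ) (φ : Fm S ar), Fm.ex x φ ∈ Φ → ∃ t : Tm S ar, φ.substF x t ∈ Φ

/-- An interpretation of `S`: a universe, interpretations of the symbols of the
appropriate arities (function symbols of arity `n > 0` as `n`-ary operations,
constants as elements via nullary operations, relation symbols of arity `-n`
as `n`-ary relations), and an assignment of the variables. -/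
structure Interp (S : Type) (ar : S → ℤ) : Type 1 where
  A : Type
  ifun : (s : S) → (Fin (ar s).toNat → A) → A
  irel : (s : S) → (Fin (-ar s).toNat → A) → Prop
  asg : ℕ → A

/-- Evaluation of terms. -/
def Interp.evalT (I : Interp S ar) : Tm S ar → I.A
  | Tm.var n => I.asg n
  | Tm.const s h => I.ifun s (fun i => absurd i.2 (by omega))
  | Tm.func s _ ts => I.ifun s (fun i => I.evalT (ts i))

/-- Mutation of the assignment at one variable. -/
def Interp.updAsg (I : Interp S ar) (x : ℕ) (a : I.A) : Interp S ar :=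
  { I with asg := Function.update I.asg x a }

/-- Tarskian satisfaction. -/
def Interp.Sat : (I : Interp S ar) → Fm S ar → Prop
  | I, Fm.eq t₁ t₂ => I.evalT t₁ = I.evalT t₂
  | I, Fm.rel s _ ts => I.irel s (fun i => I.evalT (ts i))
  | I, Fm.nor φ ψ => ¬ Interp.Sat I φ ∧ ¬ Interp.Sat I ψ
  | I, Fm.ex x φ => ∃ a : I.A, Interp.Sat (I.updAsg x a) φ

/-- `Φ` is satisfiable: some interpretation makes every formula of `Φ` true. -/
def Satisfiable (Φ : Set (Fm S ar)) : Prop := ∃ I : Interp S ar, ∀ φ ∈ Φ, I.Sat φ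

/-- Semantic entailment `Φ ⊨ φ`. -/
def Entails (Φ : Set (Fm S ar)) (φ : Fm S ar) : Prop :=
  ∀ I : Interp S ar, (∀ ψ ∈ Φ, I.Sat ψ) → I.Sat φ
variable {S : Type} {ar : S → ℤ}

/-- Polish-notation string of a term, as a word over the alphabet. -/
def Tm.toStr : Tm S ar → List (Alph S)
  | Tm.var n => [Alph.var n]
  | Tm.const s _ => [Alph.sym s]
  | Tm.func s _ ts => Alph.sym s :: (List.ofFn (fun i => (ts i).toStr)).flatten

/-- The relation `t₁ E_{(Φ,D)} t₂` iff `Φ ⊢_D ≡t₁t₂`. -/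
def Erel (D : Set Rule) (Φ : Set (Fm S ar)) (t₁ t₂ : Tm S ar) : Prop :=
  Derives D Φ (Fm.eq t₁ t₂)

/-- The Henkin interpretation `I_{(Φ,D)}`: the quotient of the term
interpretation `I_Φ` by the relation `E_{(Φ,D)}`. -/
noncomputable def henkin (D : Set Rule) (Φ : Set (Fm S ar)) : Interp S ar where
  A := Quot (Erel D Φ)
  ifun s f :=
    if h : 0 < ar s then Quot.mk _ (Tm.func s h (fun i => (f i).out))
    else if h0 : ar s = 0 then Quot.mk _ (Tm.const s h0)
    else Quot.mk _ (Tm.var 0)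
  irel s f := ∃ h : ar s < 0, Fm.rel s h (fun i => (f i).out) ∈ Φ
  asg n := Quot.mk _ (Tm.var n)

open Classical in
/-- The maximization sequence `Φ_j` of `Φ` along an enumeration `e` of the formulas. -/
noncomputable def maxSeq (D : Set Rule) (e : ℕ → Fm S ar) (Φ : Set (Fm S ar)) : ℕ → Set (Fm S ar)
  | 0 => Φ
  | n + 1 => maxSeq D e Φ n ∪
      {if Derives D (maxSeq D e Φ n) (e n).neg then (e n).neg else e n}

/-- `M⁺_D(Φ)`, the maximization of `Φ`. -/
noncomputable def Mplus (D : Set Rule) (e : ℕ → Fm S ar) (Φ : Set (Fm S ar)) : Set (Fm S ar) :=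
  ⋃ n, maxSeq D e Φ n

/-- A derivation of a sequent whose last (root) rule application is a rule of `D`
and all other rule applications use rules of `D₀`. -/
inductive DerTop (D₀ D : Set Rule) : Finset (Fm S ar) → Fm S ar → Prop where
  | ass : Rule.ass ∈ D → ∀ {Γ : Finset (Fm S ar)} {φ : Fm S ar}, φ ∈ Γ → DerTop D₀ D Γ φ
  | ant : Rule.ant ∈ D → ∀ {Γ Γ' : Finset (Fm S ar)} {φ : Fm S ar},
      Γ ⊆ Γ' → Der D₀ Γ φ → DerTop D₀ D Γ' φ
  | refl : Rule.refl ∈ D → ∀ t : Tm S ar, DerTop D₀ D ∅ (Fm.eq t t)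
  | subst : Rule.subst ∈ D → ∀ {Γ : Finset (Fm S ar)} (φ : Fm S ar) (x : ℕ) (t t' : Tm S ar),
      Der D₀ Γ (φ.substF x t) → DerTop D₀ D (insert (Fm.eq t t') Γ) (φ.substF x t')
  | exS : Rule.exS ∈ D → ∀ {Γ : Finset (Fm S ar)} (φ : Fm S ar) (x : ℕ) (t : Tm S ar),
      Der D₀ Γ (φ.substF x t) → DerTop D₀ D Γ (Fm.ex x φ)
  | exA : Rule.exA ∈ D → ∀ {Γ : Finset (Fm S ar)} (φ ψ : Fm S ar) (x x' : ℕ),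
      x' ∉ FreeSet ((↑Γ : Set (Fm S ar)) ∪ {Fm.ex x φ, ψ}) →
      Der D₀ (insert (φ.substF x (Tm.var x')) Γ) ψ → DerTop D₀ D (insert (Fm.ex x φ) Γ) ψ
  | norI : Rule.norI ∈ D → ∀ {Γ : Finset (Fm S ar)} {φ₁ φ₂ : Fm S ar},
      Der D₀ Γ (Fm.nor φ₁ φ₁) → Der D₀ Γ (Fm.nor φ₂ φ₂) → DerTop D₀ D Γ (Fm.nor φ₁ φ₂)
  | norS : Rule.norS ∈ D → ∀ {Γ : Finset (Fm S ar)} {φ₁ φ₂ : Fm S ar},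
      Der D₀ Γ (Fm.nor φ₁ φ₂) → DerTop D₀ D Γ (Fm.nor φ₂ φ₁)
  | ctrP : Rule.ctrP ∈ D → ∀ {Γ : Finset (Fm S ar)} {φ ψ : Fm S ar},
      Der D₀ (insert φ Γ) ψ → Der D₀ (insert φ Γ) ψ.neg → DerTop D₀ D Γ φ.neg
  | ctrN : Rule.ctrN ∈ D → ∀ {Γ : Finset (Fm S ar)} {φ ψ : Fm S ar},
      Der D₀ (insert φ.neg Γ) ψ → Der D₀ (insert φ.neg Γ) ψ.neg → DerTop D₀ D Γ φ
theorem Derives.of_mem {D : Set Rule} (hass : Rule.ass ∈ D) {Φ : Set (Fm S ar)} {φ : Fm S ar}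
    (h : φ ∈ Φ) : Derives D Φ φ :=
  ⟨{φ}, by simpa using h, Der.ass hass (Finset.mem_singleton_self φ)⟩

/-- If `D` includes the Assumption rule, `Φ` is `D`-maximal iff it is a minimal
covering and `D`-expanded. -/
theorem stmt1 {S : Type} [Countable S] {ar : S → ℤ} (D : Set Rule)
    (hass : Rule.ass ∈ D) (Φ : Set (Fm S ar)) :
    DMaximal D Φ ↔ (MinimalCovering Φ ∧ Expanded D Φ) := by
  constructor
  · rintro ⟨hcons, hcov⟩
    refine ⟨fun φ => ?_, fun φ hφ => (hcov φ).resolve_right fun hneg =>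
      hcons ⟨φ, hφ, .of_mem hass hneg⟩⟩
    have hboth : ¬ (φ ∈ Φ ∧ φ.neg ∈ Φ) := fun h =>
      hcons ⟨φ, .of_mem hass h.1, .of_mem hass h.2⟩
    have := hcov φ
    tauto
  · rintro ⟨hmin, hexp⟩
    refine ⟨?_, fun φ => (hmin φ).imp And.left And.right⟩
    rintro ⟨φ, hφ, hneg⟩
    rcases hmin φ with h | h
    · exact h.2 (hexp _ hneg)
    · exact h.1 (hexp _ hφ)
end

section
/- The set T^S of terms is unambiguous in the free semigroup over the alphabet: if t and t' are terms (in Polish notation) and y, y' are arbitrary nonempty strings over the alphabet such that the concatenations satisfy t·y = t'·y', then t = t' and y = y'. Consequently no term is a proper prefix of another term. -/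
variable {S : Type} {ar : S → ℤ}

variable {S : Type} {ar : S → ℤ}

/-- Finite families of codewords of a uniquely readable encoding are determined by any word
that starts with their concatenation. -/
theorem flatten_ofFn_append_cancel {α β : Type*} {n : ℕ} (enc : β → List α) (f g : Fin n → β)
    (h : ∀ i (b : β) (y y' : List α), enc (f i) ++ y = enc b ++ y' → f i = b ∧ y = y')
    {y y' : List α}
    (e : (List.ofFn fun i => enc (f i)).flatten ++ y =
      (List.ofFn fun i => enc (g i)).flatten ++ y') : f = g ∧ y = y' := by
  induction n with
  | zero => exact ⟨Subsingleton.elim _ _, by simpa using e⟩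
  | succ n ih =>
    simp only [List.ofFn_succ, List.flatten_cons, List.append_assoc] at e
    obtain ⟨h0, e⟩ := h 0 _ _ _ e
    obtain ⟨hs, e⟩ := ih (fun i => f i.succ) (fun i => g i.succ) (fun i => h i.succ) e
    exact ⟨funext (Fin.cases h0 (congrFun hs)), e⟩

/-- Unique readability of terms in Polish notation. -/
theorem Tm.toStr_append_cancel (t t' : Tm S ar) (y y' : List (Alph S))
    (e : t.toStr ++ y = t'.toStr ++ y') : t = t' ∧ y = y' := by
  induction t generalizing t' y y' with
  | var n => cases t' <;> simp_all [Tm.toStr]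
  | const s hs =>
    cases t' with
    | var => simp [Tm.toStr] at e
    | const => simpa [Tm.toStr] using e
    | func s' hs' =>
      obtain ⟨rfl, -⟩ : s = s' ∧ _ := by simpa [Tm.toStr] using e
      omega
  | func s hs ts ih =>
    cases t' with
    | var => simp [Tm.toStr] at e
    | const s' hs' =>
      obtain ⟨rfl, -⟩ : s = s' ∧ _ := by simpa [Tm.toStr] using e
      omega
    | func s' hs' ts' =>
      simp only [Tm.toStr, List.cons_append, List.cons.injEq, Alph.sym.injEq] at e
      obtain ⟨rfl, e⟩ := e
      obtain ⟨rfl, hy⟩ := flatten_ofFn_append_cancel Tm.toStr ts ts' ih e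
      exact ⟨rfl, hy⟩

/-- Unambiguity of the set of terms in the free semigroup over the alphabet:
if `t·y = t'·y'` with `t, t'` terms and `y, y'` nonempty strings, then `t = t'`
and `y = y'`; consequently no term is a proper prefix of another term. -/
theorem stmt6 {S : Type} {ar : S → ℤ} :
    (∀ (t t' : Tm S ar) (y y' : List (Alph S)), y ≠ [] → y' ≠ [] →
      t.toStr ++ y = t'.toStr ++ y' → t = t' ∧ y = y') ∧
    (∀ t t' : Tm S ar, t.toStr <+: t'.toStr → t.toStr = t'.toStr) := by
  refine ⟨fun t t' y y' _ _ e => t.toStr_append_cancel t' y y' e, ?_⟩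
  rintro t t' ⟨y, e⟩
  rw [(t.toStr_append_cancel t' y [] (by simpa using e)).1]
end

section
/- Suppose the rule set D includes the Assumption, Antecedent, Reflexivity of equality, and Substitution through equality rules, and Φ ⊆ F^S is D-expanded. Then the equivalence relation E_{(Φ,D)} on terms (t₁ E t₂ iff Φ ⊢_D ≡t₁t₂) is a congruence for the term interpretation I_Φ: for every function symbol s (#(s) > 0), if t_j E t'_j for j = 1,…,#(s) then Φ ⊢_D ≡ (s t₁…t_{#(s)}) (s t'₁…t'_{#(s)}); and for every relation symbol s (#(s) < 0), if t_j E t'_j for j = 1,…,|#(s)| then s t₁…t_{|#(s)|} ∈ Φ iff s t'₁…t'_{|#(s)|} ∈ Φ. -/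
variable {S : Type} {ar : S → ℤ}

variable {S : Type} {ar : S → ℤ}

theorem Tm.finite_varsT {S : Type} {ar : S → ℤ} (t : Tm S ar) : t.varsT.Finite := by
  induction t with
  | var n => exact Set.finite_singleton n
  | const s h => exact Set.finite_empty
  | func s h ts ih => exact Set.finite_iUnion ih

theorem Tm.substT_of_notMem {S : Type} {ar : S → ℤ} {t : Tm S ar} {x : ℕ} (u : Tm S ar)
    (hx : x ∉ t.varsT) : t.substT x u = t := by
  induction t with
  | var n => exact if_neg fun h => hx h.symm
  | const s h => rfl
  | func s h ts ih =>
    simp only [Tm.varsT, Set.mem_iUnion, not_exists] at hx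
    simp only [Tm.substT, ih _ (hx _)]

/-- A variable that occurs in none of finitely many terms. -/
theorem Tm.exists_fresh {S : Type} {ar : S → ℤ} {ι : Type} [Finite ι] (f : ι → Tm S ar) :
    ∃ x : ℕ, ∀ i, x ∉ (f i).varsT := by
  obtain ⟨x, hx⟩ := (Set.finite_iUnion fun i => (f i).finite_varsT).exists_notMem
  exact ⟨x, fun i hi => hx (Set.mem_iUnion_of_mem i hi)⟩

/-- Substituting for a fresh variable placed in the `k`-th argument updates that argument. -/
theorem Tm.substT_update_var {S : Type} {ar : S → ℤ} {ι : Type} [DecidableEq ι]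
    {f : ι → Tm S ar} {x : ℕ} (hx : ∀ i, x ∉ (f i).varsT) (k : ι) (u : Tm S ar) :
    (fun i => (Function.update f k (Tm.var x) i).substT x u) = Function.update f k u := by
  funext i
  rcases eq_or_ne i k with rfl | hik
  · simp [Tm.substT]
  · simp [hik, Tm.substT_of_notMem u (hx i)]

/-- A predicate on tuples that is stable under replacing one argument by a related one is
stable under replacing all arguments. -/
theorem of_forall_update {ι α : Type*} [Fintype ι] [DecidableEq ι]
    {P : (ι → α) → Prop} {f g : ι → α}
    (hstep : ∀ (e : ι → α) (k : ι), P (Function.update e k (f k)) → P (Function.update e k (g k)))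
    (hf : P f) : P g := by
  suffices h : ∀ s : Finset ι, P (s.piecewise g f) by
    simpa using h Finset.univ
  intro s
  induction s using Finset.induction_on with
  | empty => simpa using hf
  | insert k s hk ih =>
    rw [Finset.piecewise_insert]
    apply hstep
    rwa [← Finset.piecewise_eq_of_notMem s g f hk, Function.update_eq_self]

theorem Expanded.substF_mem {S : Type} {ar : S → ℤ} {D : Set Rule} {Φ : Set (Fm S ar)}
    (hexp : Expanded D Φ) (hass : Rule.ass ∈ D) (hsubst : Rule.subst ∈ D)
    (φ : Fm S ar) (x : ℕ) {t t' : Tm S ar} (heq : Fm.eq t t' ∈ Φ) (h : φ.substF x t ∈ Φ) :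
    φ.substF x t' ∈ Φ := by
  refine hexp _ ⟨insert (Fm.eq t t') {φ.substF x t}, ?_,
    Der.subst hsubst φ x t t' (Der.ass hass (Finset.mem_singleton_self _))⟩
  simp [Set.insert_subset_iff, heq, h]

theorem Expanded.eq_refl_mem {S : Type} {ar : S → ℤ} {D : Set Rule} {Φ : Set (Fm S ar)}
    (hexp : Expanded D Φ) (hrefl : Rule.refl ∈ D) (t : Tm S ar) : Fm.eq t t ∈ Φ :=
  hexp _ ⟨∅, by simp, Der.refl hrefl t⟩

theorem Expanded.eq_symm_mem {S : Type} {ar : S → ℤ} {D : Set Rule} {Φ : Set (Fm S ar)}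
    (hexp : Expanded D Φ) (hass : Rule.ass ∈ D) (hrefl : Rule.refl ∈ D) (hsubst : Rule.subst ∈ D)
    {t t' : Tm S ar} (h : Fm.eq t t' ∈ Φ) : Fm.eq t' t ∈ Φ := by
  obtain ⟨x, hx⟩ := Tm.exists_fresh fun _ : Unit => t
  have key := hexp.substF_mem hass hsubst (Fm.eq (Tm.var x) t) x h
  simp only [Fm.substF, Tm.substT, if_true, Tm.substT_of_notMem _ (hx ())] at key
  exact key (hexp.eq_refl_mem hrefl t)

theorem Expanded.eq_func_mem {S : Type} {ar : S → ℤ} {D : Set Rule} {Φ : Set (Fm S ar)}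
    (hexp : Expanded D Φ) (hass : Rule.ass ∈ D) (hrefl : Rule.refl ∈ D) (hsubst : Rule.subst ∈ D)
    {s : S} (h : 0 < ar s) {ts ts' : Fin (ar s).toNat → Tm S ar}
    (heq : ∀ i, Fm.eq (ts i) (ts' i) ∈ Φ) :
    Fm.eq (Tm.func s h ts) (Tm.func s h ts') ∈ Φ := by
  refine of_forall_update (P := fun e => Fm.eq (Tm.func s h ts) (Tm.func s h e) ∈ Φ)
    (fun e k => ?_) (hexp.eq_refl_mem hrefl (Tm.func s h ts))
  obtain ⟨x, hx⟩ := Tm.exists_fresh (Sum.elim ts e)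
  have hts (i) : x ∉ (ts i).varsT := hx (Sum.inl i)
  have he (i) : x ∉ (e i).varsT := hx (Sum.inr i)
  have key := hexp.substF_mem hass hsubst
    (Fm.eq (Tm.func s h ts) (Tm.func s h (Function.update e k (Tm.var x)))) x (heq k)
  simpa only [Fm.substF, Tm.substT, Tm.substT_update_var he,
    Tm.substT_of_notMem _ (hts _)] using key

theorem Expanded.rel_mem {S : Type} {ar : S → ℤ} {D : Set Rule} {Φ : Set (Fm S ar)}
    (hexp : Expanded D Φ) (hass : Rule.ass ∈ D) (hsubst : Rule.subst ∈ D)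
    {s : S} (h : ar s < 0) {ts ts' : Fin (-ar s).toNat → Tm S ar}
    (heq : ∀ i, Fm.eq (ts i) (ts' i) ∈ Φ) (hts : Fm.rel s h ts ∈ Φ) : Fm.rel s h ts' ∈ Φ := by
  refine of_forall_update (P := fun e => Fm.rel s h e ∈ Φ) (fun e k => ?_) hts
  obtain ⟨x, hx⟩ := Tm.exists_fresh e
  have key := hexp.substF_mem hass hsubst
    (Fm.rel s h (Function.update e k (Tm.var x))) x (heq k)
  simpa only [Fm.substF, Tm.substT_update_var hx] using key

/-- For `D` including Assumption, Antecedent, Reflexivity and Substitution, and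
`Φ` `D`-expanded, the relation `E_{(Φ,D)}` is a congruence for the term
interpretation `I_Φ`: it is preserved by the function symbols and it preserves
membership in `Φ` of relational atoms. -/
theorem stmt11 {S : Type} [Countable S] {ar : S → ℤ} (D : Set Rule)
    (hass : Rule.ass ∈ D) (hant : Rule.ant ∈ D)
    (hrefl : Rule.refl ∈ D) (hsubst : Rule.subst ∈ D)
    (Φ : Set (Fm S ar)) (hexp : Expanded D Φ) :
    (∀ (s : S) (h : 0 < ar s) (ts ts' : Fin (ar s).toNat → Tm S ar),
      (∀ i, Derives D Φ (Fm.eq (ts i) (ts' i))) →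
      Derives D Φ (Fm.eq (Tm.func s h ts) (Tm.func s h ts'))) ∧
    (∀ (s : S) (h : ar s < 0) (ts ts' : Fin (-ar s).toNat → Tm S ar),
      (∀ i, Derives D Φ (Fm.eq (ts i) (ts' i))) →
      (Fm.rel s h ts ∈ Φ ↔ Fm.rel s h ts' ∈ Φ)) := by
  refine ⟨fun s h ts ts' heq => ?_, fun s h ts ts' heq => ?_⟩
  · have hmem := hexp.eq_func_mem hass hrefl hsubst h fun i => hexp _ (heq i)
    exact ⟨{Fm.eq (Tm.func s h ts) (Tm.func s h ts')}, by simpa using hmem,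
      Der.ass hass (Finset.mem_singleton_self _)⟩
  · exact ⟨hexp.rel_mem hass hsubst h fun i => hexp _ (heq i),
      hexp.rel_mem hass hsubst h fun i =>
        hexp.eq_symm_mem hass hrefl hsubst (hexp _ (heq i))⟩
end

section
/- If D⁺ ⊆ D are rule sets with D⁺ containing the nine rules Assumption, Antecedent, Reflexivity of equality, Substitution through equality, ∃-introduction in antecedent, ∃-introduction in succedent, NOR introduction, NOR symmetry, and Contradiction+, then for every Φ ⊆ F^S: Φ is D⁺-consistent if and only if Φ is D-consistent. -/
variable {S : Type} {ar : S → ℤ}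

variable {S : Type} {ar : S → ℤ}

theorem Der.mono {D₀ D : Set Rule} (h : D₀ ⊆ D) {Γ : Finset (Fm S ar)} {φ : Fm S ar}
    (d : Der D₀ Γ φ) : Der D Γ φ := by
  induction d with
  | ass r m => exact .ass (h r) m
  | ant r m _ ih => exact .ant (h r) m ih
  | refl r t => exact .refl (h r) t
  | subst r φ x t t' _ ih => exact .subst (h r) φ x t t' ih
  | exS r φ x t _ ih => exact .exS (h r) φ x t ih
  | exA r φ ψ x x' m _ ih => exact .exA (h r) φ ψ x x' m ih
  | norI r _ _ ih₁ ih₂ => exact .norI (h r) ih₁ ih₂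
  | norS r _ ih => exact .norS (h r) ih
  | ctrP r _ _ ih₁ ih₂ => exact .ctrP (h r) ih₁ ih₂
  | ctrN r _ _ ih₁ ih₂ => exact .ctrN (h r) ih₁ ih₂

theorem Fm.freeF_neg (φ : Fm S ar) : φ.neg.freeF = φ.freeF := Set.union_self _

section NegativeFragment

variable {D : Set Rule} {Γ : Finset (Fm S ar)} {φ ψ : Fm S ar}

/-- Double negation introduction. -/
theorem Der.neg_neg (ha : Rule.ass ∈ D) (hw : Rule.ant ∈ D) (hc : Rule.ctrP ∈ D)
    (d : Der D Γ φ) : Der D Γ φ.neg.neg :=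
  .ctrP hc (.ant hw (Finset.subset_insert _ _) d) (.ass ha (Finset.mem_insert_self _ _))

/-- Triple negation elimination. -/
theorem Der.neg_of_neg_neg_neg (ha : Rule.ass ∈ D) (hw : Rule.ant ∈ D) (hc : Rule.ctrP ∈ D)
    (d : Der D Γ φ.neg.neg.neg) : Der D Γ φ.neg :=
  .ctrP hc (Der.neg_neg ha hw hc (.ass ha (Finset.mem_insert_self _ _)))
    (.ant hw (Finset.subset_insert _ _) d)

/-- A derivation of `ψ` from `φ` lifts to double negations. -/
theorem Der.neg_neg_map (ha : Rule.ass ∈ D) (hw : Rule.ant ∈ D) (hc : Rule.ctrP ∈ D)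
    (h : Der D {φ} ψ) (d : Der D Γ φ.neg.neg) : Der D Γ ψ.neg.neg := by
  have hφ : Der D (insert ψ.neg Γ) φ.neg :=
    .ctrP hc (.ant hw (by simp) h) (.ass ha (by simp))
  exact .ctrP hc hφ (.ant hw (Finset.subset_insert _ _) d)

end NegativeFragment

/-- Glivenko's theorem: dropping Contradiction− preserves derivability up to double negation. -/
theorem Der.glivenko {Dp D : Set Rule}
    (h1 : Rule.ass ∈ Dp) (h2 : Rule.ant ∈ Dp) (h3 : Rule.refl ∈ Dp)
    (h4 : Rule.subst ∈ Dp) (h5 : Rule.exA ∈ Dp) (h6 : Rule.exS ∈ Dp)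
    (h7 : Rule.norI ∈ Dp) (h8 : Rule.norS ∈ Dp) (h9 : Rule.ctrP ∈ Dp)
    {Γ : Finset (Fm S ar)} {φ : Fm S ar} (d : Der D Γ φ) : Der Dp Γ φ.neg.neg := by
  induction d with
  | ass _ m => exact (Der.ass h1 m).neg_neg h1 h2 h9
  | ant _ m _ ih => exact .ant h2 m ih
  | refl _ t => exact (Der.refl h3 t).neg_neg h1 h2 h9
  | subst _ φ x t t' _ ih => exact .subst h4 φ.neg.neg x t t' ih
  | exS _ φ x t _ ih =>
    exact Der.neg_neg_map h1 h2 h9 (.exS h6 φ x t (.ass h1 (Finset.mem_singleton_self _))) ih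
  | exA _ φ ψ x x' m _ ih =>
    refine .exA h5 φ ψ.neg.neg x x' ?_ ih
    simpa [FreeSet, Fm.freeF_neg] using m
  | norI _ _ _ ih₁ ih₂ =>
    exact (Der.norI h7 (Der.neg_of_neg_neg_neg h1 h2 h9 ih₁)
      (Der.neg_of_neg_neg_neg h1 h2 h9 ih₂)).neg_neg h1 h2 h9
  | norS _ _ ih =>
    exact Der.neg_neg_map h1 h2 h9 (.norS h8 (.ass h1 (Finset.mem_singleton_self _))) ih
  | ctrP _ _ _ ih₁ ih₂ => exact (Der.ctrP h9 ih₁ ih₂).neg_neg h1 h2 h9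
  | ctrN _ _ _ ih₁ ih₂ => exact .ctrP h9 ih₁ ih₂

/-- If `D⁺ ⊆ D` and `D⁺` contains the nine basic rules other than
Contradiction−, then `D⁺`-consistency and `D`-consistency coincide. -/
theorem stmt18 {S : Type} [Countable S] {ar : S → ℤ} (Dp D : Set Rule)
    (hsub : Dp ⊆ D)
    (h1 : Rule.ass ∈ Dp) (h2 : Rule.ant ∈ Dp) (h3 : Rule.refl ∈ Dp)
    (h4 : Rule.subst ∈ Dp) (h5 : Rule.exA ∈ Dp) (h6 : Rule.exS ∈ Dp)
    (h7 : Rule.norI ∈ Dp) (h8 : Rule.norS ∈ Dp) (h9 : Rule.ctrP ∈ Dp)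
    (Φ : Set (Fm S ar)) :
    Consistent Dp Φ ↔ Consistent D Φ := by
  refine not_congr ⟨?_, ?_⟩
  · rintro ⟨φ, ⟨Γ, hΓ, d⟩, ⟨Δ, hΔ, e⟩⟩
    exact ⟨φ, ⟨Γ, hΓ, d.mono hsub⟩, ⟨Δ, hΔ, e.mono hsub⟩⟩
  · rintro ⟨φ, ⟨Γ, hΓ, d⟩, ⟨Δ, hΔ, e⟩⟩
    exact ⟨φ.neg.neg, ⟨Γ, hΓ, d.glivenko h1 h2 h3 h4 h5 h6 h7 h8 h9⟩,
      ⟨Δ, hΔ, e.glivenko h1 h2 h3 h4 h5 h6 h7 h8 h9⟩⟩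
end
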